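/- There exists an absolute constant c > 0 such that for every combinatorial market in which each consumer's valuation is a weighted matroid rank function, there exist a price q ≥ 0 and a competitive equilibrium with reserve q whose revenue is at least c · OPT / (log(m) + 2). -/

import Mathlib

open Finset

/-- A combinatorial market with `n` consumers and `m` items. Each consumer has a
normalized (`v i ∅ = 0`) and monotone valuation over subsets of items. -/
structure Market (n m : ℕ) where
  v : Fin n → Finset (Fin m) → ℝ
  v_empty : ∀ i, v i ∅ = 0
  v_mono : ∀ i, ∀ S T : Finset (Fin m), S ⊆ T → v i S ≤ v i T

/-- An allocation assigns pairwise disjoint sets of items to consumers. -/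
def IsAllocation {n m : ℕ} (S : Fin n → Finset (Fin m)) : Prop :=
  ∀ i j : Fin n, i ≠ j → Disjoint (S i) (S j)

/-- The welfare of an allocation. -/
def allocWelfare {n m : ℕ} (Mk : Market n m) (S : Fin n → Finset (Fin m)) : ℝ :=
  ∑ i, Mk.v i (S i)

/-- The optimal welfare over all allocations. -/
noncomputable def OPT {n m : ℕ} (Mk : Market n m) : ℝ :=
  sSup {w : ℝ | ∃ S : Fin n → Finset (Fin m), IsAllocation S ∧ allocWelfare Mk S = w}

/-- A competitive bundling equilibrium: a partition of the items into nonempty bundles,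
nonnegative bundle prices, and an assignment of every bundle to a consumer (market
clearance), such that every consumer's assigned set of bundles maximizes his profit
over all sets of bundles. -/
structure CBE {n m : ℕ} (Mk : Market n m) where
  bundles : Finset (Finset (Fin m))
  price : Finset (Fin m) → ℝ
  assign : Finset (Fin m) → Fin n
  bundles_nonempty : ∀ b ∈ bundles, b.Nonempty
  bundles_disjoint : ∀ b ∈ bundles, ∀ b' ∈ bundles, b ≠ b' → Disjoint b b'
  bundles_cover : bundles.biUnion id = Finset.univ
  price_nonneg : ∀ b ∈ bundles, 0 ≤ price b
  profit_max : ∀ i : Fin n, ∀ T : Finset (Finset (Fin m)), T ⊆ bundles →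
    Mk.v i ((bundles.filter fun b => assign b = i).biUnion id)
        - ∑ b ∈ bundles.filter fun b => assign b = i, price b
      ≥ Mk.v i (T.biUnion id) - ∑ b ∈ T, price b

/-- The welfare of a competitive bundling equilibrium. -/
def CBE.welfare {n m : ℕ} {Mk : Market n m} (E : CBE Mk) : ℝ :=
  ∑ i, Mk.v i ((E.bundles.filter fun b => E.assign b = i).biUnion id)

/-- The revenue of a competitive bundling equilibrium. -/
def CBE.revenue {n m : ℕ} {Mk : Market n m} (E : CBE Mk) : ℝ :=
  ∑ b ∈ E.bundles, E.price b

/-- A market is multi-unit if valuations depend only on the number of items. -/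
def MultiUnit {n m : ℕ} (Mk : Market n m) : Prop :=
  ∀ i, ∀ S T : Finset (Fin m), S.card = T.card → Mk.v i S = Mk.v i T

def Demanded {m : ℕ} (v : Finset (Fin m) → ℝ) (p : Fin m → ℝ) (D : Finset (Fin m)) : Prop :=
  ∀ T, v T - ∑ j ∈ T, p j ≤ v D - ∑ j ∈ D, p j

def GS {m : ℕ} (v : Finset (Fin m) → ℝ) : Prop :=
  ∀ p p' : Fin m → ℝ, (∀ j, p j ≤ p' j) → ∀ D, Demanded v p D →
    ∃ D', Demanded v p' D' ∧ ∀ j ∈ D, p j = p' j → j ∈ D'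

def Exch {m : ℕ} (v : Finset (Fin m) → ℝ) : Prop :=
  ∀ D T : Finset (Fin m), ∀ a ∈ D, a ∉ T →
    v D + v T ≤ v (D.erase a) + v (insert a T) ∨
    ∃ b ∈ T, b ∉ D ∧ v D + v T ≤ v (insert b (D.erase a)) + v (insert a (T.erase b))

lemma exists_demanded {m : ℕ} (v : Finset (Fin m) → ℝ) (p : Fin m → ℝ) : ∃ D, Demanded v p D := by
  obtain ⟨D, hD⟩ := Finite.exists_max (fun T : Finset (Fin m) => v T - ∑ j ∈ T, p j)
  exact ⟨D, hD⟩

lemma sum_update_notMem {m : ℕ} (p : Fin m → ℝ) (a : Fin m) (x : ℝ) (D : Finset (Fin m))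
    (h : a ∉ D) : ∑ j ∈ D, Function.update p a x j = ∑ j ∈ D, p j := by
  apply Finset.sum_congr rfl
  intro j hj
  rw [Function.update_of_ne]
  rintro rfl; exact h hj

lemma sum_update_mem {m : ℕ} (p : Fin m → ℝ) (a : Fin m) (x : ℝ) (D : Finset (Fin m))
    (h : a ∈ D) : ∑ j ∈ D, Function.update p a x j = ∑ j ∈ D, p j + (x - p a) := by
  rw [← Finset.add_sum_erase _ _ h, ← Finset.add_sum_erase D p h,
    sum_update_notMem _ _ _ _ (Finset.notMem_erase a D)]
  simp only [Function.update_self]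
  ring

lemma single_raise {m : ℕ} (v : Finset (Fin m) → ℝ) (hv : Exch v) (p : Fin m → ℝ) (a : Fin m)
    (x : ℝ) (hx : p a ≤ x) (D : Finset (Fin m)) (hD : Demanded v p D) :
    ∃ D', Demanded v (Function.update p a x) D' ∧ ∀ j ∈ D, j ≠ a → j ∈ D' := by
  by_cases hopt : Demanded v (Function.update p a x) D
  · exact ⟨D, hopt, fun j hj _ => hj⟩
  obtain ⟨T, hT⟩ := exists_demanded v (Function.update p a x)
  have haD : a ∈ D := by
    by_contra ha
    apply hopt
    intro R
    rw [sum_update_notMem _ _ _ _ ha]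
    have := hD R
    by_cases hR : a ∈ R
    · rw [sum_update_mem _ _ _ _ hR]; linarith
    · rw [sum_update_notMem _ _ _ _ hR]; linarith
  have haT : a ∉ T := by
    intro ha
    apply hopt
    intro R
    have h1 := hT R
    have h2 := hD T
    rw [sum_update_mem _ _ _ _ ha] at h1
    rw [sum_update_mem _ _ _ _ haD]
    linarith
  have key : ∀ D', a ∉ D' → v T - ∑ j ∈ T, p j ≤ v D' - ∑ j ∈ D', p j →
      Demanded v (Function.update p a x) D' := by
    intro D' h h2 R
    have h1 := hT R
    rw [sum_update_notMem _ _ _ _ haT] at h1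
    rw [sum_update_notMem _ _ _ _ h]
    linarith
  rcases hv D T a haD haT with h | ⟨b, hbT, hbD, h⟩
  · refine ⟨D.erase a, key _ (Finset.notMem_erase a D) ?_, fun j hj hja => Finset.mem_erase.2 ⟨hja, hj⟩⟩
    have h1 := hD (insert a T)
    rw [Finset.sum_insert haT] at h1
    rw [← Finset.add_sum_erase D p haD] at h1
    linarith
  · have hba : b ≠ a := by rintro rfl; exact haT hbT
    have hbE : b ∉ D.erase a := fun h => hbD (Finset.mem_of_mem_erase h)
    refine ⟨insert b (D.erase a), key _ ?_ ?_, fun j hj hja =>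
      Finset.mem_insert_of_mem (Finset.mem_erase.2 ⟨hja, hj⟩)⟩
    · simp [hba.symm]
    have h1 := hD (insert a (T.erase b))
    rw [Finset.sum_insert (fun h => haT (Finset.mem_of_mem_erase h))] at h1
    rw [← Finset.add_sum_erase D p haD] at h1
    rw [Finset.sum_insert hbE, ← Finset.add_sum_erase T p hbT]
    linarith

lemma gs_of_exch {m : ℕ} (v : Finset (Fin m) → ℝ) (hv : Exch v) : GS v := by
  intro p p' hp D hD
  have key : ∀ R : Finset (Fin m), ∃ D', Demanded v (fun j => if j ∈ R then p' j else p j) D' ∧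
      ∀ j ∈ D, p j = p' j → j ∈ D' := by
    intro R
    induction R using Finset.induction_on with
    | empty => exact ⟨D, by simpa using hD, fun j hj _ => hj⟩
    | insert a R ha ih =>
      obtain ⟨D', h1, h2⟩ := ih
      by_cases hpa : p a = p' a
      · refine ⟨D', ?_, h2⟩
        convert h1 using 2 with j
        by_cases hj : j = a
        · subst hj; simp [hpa]
        · simp [hj]
      obtain ⟨D'', h3, h4⟩ := single_raise v hv _ a (p' a) (by simpa [ha] using hp a) D' h1
      refine ⟨D'', ?_, ?_⟩
      · convert h3 using 1
        funext j
        by_cases hj : j = a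
        · subst hj; simp
        · simp [hj]
      · intro j hj hpj
        exact h4 j (h2 j hj hpj) (by rintro rfl; exact hpa hpj)
  obtain ⟨D', h1, h2⟩ := key univ
  exact ⟨D', by simpa using h1, h2⟩

/-- the exchange property of weighted matroid rank functions -/
lemma exch_of_matroid {m : ℕ} (v : Finset (Fin m) → ℝ) (M : Matroid (Fin m)) (w : Fin m → ℝ)
    (hE : M.E = Set.univ)
    (hv : ∀ S : Finset (Fin m),
      IsGreatest {x : ℝ | ∃ U : Finset (Fin m), U ⊆ S ∧ M.Indep ↑U ∧ x = ∑ j ∈ U, w j} (v S)) :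
    Exch v := by
  have hge : ∀ S U : Finset (Fin m), U ⊆ S → M.Indep ↑U → ∑ j ∈ U, w j ≤ v S :=
    fun S U h1 h2 => (hv S).2 ⟨U, h1, h2, rfl⟩
  intro D T a haD haT
  obtain ⟨U, hUD, hU, hvU⟩ := (hv D).1
  obtain ⟨V, hVT, hV, hvV⟩ := (hv T).1
  have haV : a ∉ V := fun h => haT (hVT h)
  by_cases haU : a ∈ U
  swap
  · left
    have h1 := hge (D.erase a) U (Finset.subset_erase.2 ⟨hUD, haU⟩) hU
    have h2 := hge (insert a T) V (hVT.trans (Finset.subset_insert _ _)) hV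
    linarith
  have hUa : M.Indep ((U.erase a : Finset (Fin m)) : Set (Fin m)) :=
    hU.subset (by exact_mod_cast Finset.erase_subset a U)
  have hsU := Finset.add_sum_erase U w haU
  by_cases hins : M.Indep ((insert a V : Finset (Fin m)) : Set (Fin m))
  · left
    have h1 := hge (D.erase a) (U.erase a) (Finset.erase_subset_erase a hUD) hUa
    have h2 := hge (insert a T) (insert a V) (Finset.insert_subset_insert a hVT) hins
    rw [Finset.sum_insert haV] at h2
    linarith
  have hcl : a ∈ M.closure ↑V := by
    rw [hV.mem_closure_iff']
    refine ⟨by simp [hE], fun h => ?_⟩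
    exact absurd (by simpa using h) hins
  have hC := hV.fundCircuit_isCircuit hcl (by exact_mod_cast haV)
  have hb : ∃ b ∈ M.fundCircuit a ↑V \ {a}, b ∉ M.closure ↑(U.erase a) := by
    by_contra hcon
    push Not at hcon
    have h1 : a ∈ M.closure (M.fundCircuit a ↑V \ {a}) :=
      hC.mem_closure_sdiff_singleton_of_mem (M.mem_fundCircuit a _)
    have h2 : a ∈ M.closure ↑(U.erase a) :=
      (M.closure_subset_closure_of_subset_closure hcon) h1
    have := hU.notMem_closure_sdiff_of_mem (e := a) (by exact_mod_cast haU)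
    apply this
    simpa using h2
  obtain ⟨b, ⟨hbC, hba⟩, hbcl⟩ := hb
  have hba : b ≠ a := hba
  have hbV : b ∈ V := by
    have := M.fundCircuit_subset_insert a (↑V) hbC
    simpa [hba] using this
  have hVab : M.Indep ((insert a (V.erase b) : Finset (Fin m)) : Set (Fin m)) := by
    have := (hV.mem_fundCircuit_iff hcl (by exact_mod_cast haV)).1 hbC
    convert this using 1
    ext j
    by_cases hj : j = a
    · subst hj; simp [hba.symm]
    · simp [hj, and_comm]
  have hbU : b ∉ U.erase a := fun h =>
    hbcl (M.mem_closure_of_mem (by exact_mod_cast h) (by simp [hE]))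
  have hUab : M.Indep ((insert b (U.erase a) : Finset (Fin m)) : Set (Fin m)) := by
    have := (hUa.notMem_closure_iff (e := b) (by simp [hE])).1 hbcl
    simpa using this.1
  have hs1 : ∑ j ∈ insert a (V.erase b), w j = w a + ∑ j ∈ V.erase b, w j :=
    Finset.sum_insert (fun h => haV (Finset.mem_of_mem_erase h))
  have hs2 : ∑ j ∈ insert b (U.erase a), w j = w b + ∑ j ∈ U.erase a, w j :=
    Finset.sum_insert hbU
  have hsV := Finset.add_sum_erase V w hbV
  by_cases hbD : b ∈ D
  · left
    have h1 := hge (D.erase a) _ (Finset.insert_subset (Finset.mem_erase.2 ⟨hba, hbD⟩)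
      (Finset.erase_subset_erase a hUD)) hUab
    have h2 := hge (insert a T) _ (Finset.insert_subset_insert a
      ((Finset.erase_subset b V).trans hVT)) hVab
    linarith
  · right
    refine ⟨b, hVT hbV, hbD, ?_⟩
    have h1 := hge (insert b (D.erase a)) _ (Finset.insert_subset_insert b
      (Finset.erase_subset_erase a hUD)) hUab
    have h2 := hge (insert a (T.erase b)) _ (Finset.insert_subset_insert a
      (Finset.erase_subset_erase b hVT)) hVab
    linarith

lemma sum_le_harmonic {ι : Type*} [DecidableEq ι] (a : ι → ℝ) (A : ℝ) (N : ℕ) :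
    ∀ I : Finset ι, I.card = N →
      (∀ e ∈ I, a e * ((I.filter fun f => a e ≤ a f).card : ℝ) ≤ A) → (∀ e ∈ I, 0 ≤ a e) →
      ∑ e ∈ I, a e ≤ A * (harmonic N : ℝ) := by
  induction N with
  | zero => intro I hI _ _; rw [Finset.card_eq_zero] at hI; subst hI; simp
  | succ N ih =>
    intro I hI h h0
    have hne : I.Nonempty := Finset.card_pos.1 (by omega)
    obtain ⟨e, he, hmin⟩ := Finset.exists_min_image I a hne
    rw [← Finset.add_sum_erase I a he, harmonic_succ]
    have h1 := ih (I.erase e) (by rw [Finset.card_erase_of_mem he]; omega) (by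
      intro f hf
      refine le_trans ?_ (h f (Finset.mem_of_mem_erase hf))
      apply mul_le_mul_of_nonneg_left _ (h0 f (Finset.mem_of_mem_erase hf))
      exact_mod_cast Finset.card_le_card (Finset.filter_subset_filter _ (Finset.erase_subset e I)))
      (fun f hf => h0 f (Finset.mem_of_mem_erase hf))
    have h2 := h e he
    rw [Finset.filter_true_of_mem hmin, hI] at h2
    have h3 : a e ≤ A * ((N + 1 : ℕ) : ℝ)⁻¹ := by
      rw [← div_eq_mul_inv, le_div_iff₀ (by positivity)]
      exact h2
    push_cast at h3 ⊢
    linarith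

/-- Prices seen by a consumer holding `S`: other items cost one increment more. -/
noncomputable def seenPrice {m : ℕ} (q ε : ℝ) (k : Fin m → ℕ) (S : Finset (Fin m)) : Fin m → ℝ :=
  fun j => q + ε * k j + if j ∈ S then 0 else ε

/-- Valid states of the ascending auction. -/
def AuctionState {n m : ℕ} (Mk : Market n m) (q ε : ℝ) (S : Fin n → Finset (Fin m))
    (k : Fin m → ℕ) : Prop :=
  IsAllocation S ∧ (∀ j, j ∉ Finset.univ.biUnion S → k j = 0) ∧
  ∀ i, ∃ D, S i ⊆ D ∧ Demanded (Mk.v i) (seenPrice q ε k (S i)) D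

lemma auction_step {n m : ℕ} (Mk : Market n m) (hgs : ∀ i, GS (Mk.v i)) (q ε : ℝ) (hε : 0 < ε)
    (S : Fin n → Finset (Fin m)) (k : Fin m → ℕ) (h : AuctionState Mk q ε S k)
    (hnt : ¬ ∀ i, Demanded (Mk.v i) (seenPrice q ε k (S i)) (S i)) :
    ∃ S' k', AuctionState Mk q ε S' k' ∧ ∑ j, k j + 1 ≤ ∑ j, k' j := by
  classical
  obtain ⟨hS, hk, hD⟩ := h
  push Not at hnt
  obtain ⟨i, hi⟩ := hnt
  obtain ⟨D, hSD, hDd⟩ := hD i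
  have hne : ∃ a ∈ D, a ∉ S i := by
    by_contra hcon
    push Not at hcon
    have : S i = D := Finset.Subset.antisymm hSD hcon
    rw [this] at hi
    rw [this] at hDd
    exact hi hDd
  obtain ⟨a, haD, haS⟩ := hne
  refine ⟨fun i' => if i' = i then D else S i' \ D,
    fun j => if j ∈ D ∧ j ∉ S i then k j + 1 else k j, ⟨?_, ?_, ?_⟩, ?_⟩
  · intro x y hxy
    by_cases hx : x = i
    · by_cases hy : y = i
      · exact absurd (hx.trans hy.symm) hxy
      · simp only [hx, hy, if_true, if_false]
        exact Finset.disjoint_sdiff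
    · by_cases hy : y = i
      · simp only [hx, hy, if_true, if_false]
        exact Finset.sdiff_disjoint
      · simp only [hx, hy, if_false]
        exact (hS x y hxy).mono Finset.sdiff_subset Finset.sdiff_subset
  · intro j hj
    simp only [Finset.mem_biUnion, Finset.mem_univ, true_and, not_exists] at hj hk
    have hjD : j ∉ D := by simpa using hj i
    have h0 : k j = 0 := by
      apply hk
      intro x hx
      by_cases hxi : x = i
      · subst hxi; exact hjD (hSD hx)
      · have := hj x
        simp [hxi, hx, hjD] at this
    simp [hjD, h0]
  · intro x
    by_cases hx : x = i
    · subst hx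
      refine ⟨D, by simp, ?_⟩
      convert hDd using 1
      funext j
      unfold seenPrice
      by_cases h1 : j ∈ D
      · by_cases h2 : j ∈ S x
        · simp [h1, h2]
        · simp [h1, h2]; ring
      · have h2 : j ∉ S x := fun h => h1 (hSD h)
        simp [h1, h2]
    · obtain ⟨E, hSE, hE⟩ := hD x
      simp only [hx, if_false]
      obtain ⟨E', hE', hsub⟩ := hgs x _ (seenPrice q ε
        (fun j => if j ∈ D ∧ j ∉ S i then k j + 1 else k j) (S x \ D)) (by
          intro j
          unfold seenPrice
          by_cases h1 : j ∈ D
          · by_cases h2 : j ∈ S i <;> by_cases h3 : j ∈ S x <;> simp [h1, h2, h3] <;> nlinarith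
          · by_cases h3 : j ∈ S x <;> simp [h1, h3]) E hE
      refine ⟨E', ?_, hE'⟩
      intro j hj
      rw [Finset.mem_sdiff] at hj
      apply hsub j (hSE hj.1)
      simp [seenPrice, hj.1, hj.2]
  · have : ∑ j, k j < ∑ j, (if j ∈ D ∧ j ∉ S i then k j + 1 else k j) := by
      apply Finset.sum_lt_sum
      · intro j _; split_ifs <;> omega
      · exact ⟨a, Finset.mem_univ _, by simp [haD, haS]⟩
    exact this

lemma v_nonneg {n m : ℕ} (Mk : Market n m) (i : Fin n) (S : Finset (Fin m)) : 0 ≤ Mk.v i S := by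
  rw [← Mk.v_empty i]; exact Mk.v_mono i _ _ (Finset.empty_subset _)

lemma auction_bound {n m : ℕ} (Mk : Market n m) (q ε : ℝ) (hq : 0 ≤ q)
    (S : Fin n → Finset (Fin m)) (k : Fin m → ℕ) (h : AuctionState Mk q ε S k) (j : Fin m) :
    ε * k j ≤ ∑ i, Mk.v i univ := by
  obtain ⟨hS, hk, hD⟩ := h
  have hB : 0 ≤ ∑ i, Mk.v i univ := Finset.sum_nonneg fun i _ => v_nonneg Mk i _
  by_cases hj : j ∈ Finset.univ.biUnion S
  · simp only [Finset.mem_biUnion, Finset.mem_univ, true_and] at hj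
    obtain ⟨i, hi⟩ := hj
    obtain ⟨D, hSD, hDd⟩ := hD i
    have h1 := hDd (D.erase j)
    rw [← Finset.add_sum_erase D _ (hSD hi)] at h1
    have h2 : seenPrice q ε k (S i) j = q + ε * k j := by simp [seenPrice, hi]
    rw [h2] at h1
    have h3 := v_nonneg Mk i (D.erase j)
    have h4 := Mk.v_mono i D univ (Finset.subset_univ _)
    have h5 : Mk.v i univ ≤ ∑ i, Mk.v i univ :=
      Finset.single_le_sum (f := fun i => Mk.v i univ) (fun i _ => v_nonneg Mk i _)
        (Finset.mem_univ i)
    linarith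
  · rw [hk j hj]; simpa using hB

lemma auction_terminal {n m : ℕ} (Mk : Market n m) (hgs : ∀ i, GS (Mk.v i)) (q ε : ℝ)
    (hq : 0 ≤ q) (hε : 0 < ε) :
    ∃ S k, AuctionState Mk q ε S k ∧ ∀ i, Demanded (Mk.v i) (seenPrice q ε k (S i)) (S i) := by
  by_contra hcon
  have key : ∀ N : ℕ, ∃ S k, AuctionState Mk q ε S k ∧ N ≤ ∑ j, k j := by
    intro N
    induction N with
    | zero =>
      refine ⟨fun _ => ∅, fun _ => 0, ⟨fun _ _ _ => by simp, fun _ _ => rfl, fun i => ?_⟩, by simp⟩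
      obtain ⟨D, hD⟩ := exists_demanded (Mk.v i) (seenPrice q ε (fun _ => 0) ∅)
      exact ⟨D, by simp, hD⟩
    | succ N ih =>
      obtain ⟨S, k, h1, h2⟩ := ih
      obtain ⟨S', k', h3, h4⟩ := auction_step Mk hgs q ε hε S k h1 (fun h => hcon ⟨S, k, h1, h⟩)
      exact ⟨S', k', h3, by omega⟩
  obtain ⟨N, hN⟩ := exists_nat_gt ((m : ℝ) * (∑ i, Mk.v i univ) / ε)
  obtain ⟨S, k, h1, h2⟩ := key N
  have h3 : ∑ j : Fin m, ε * (k j : ℝ) ≤ ∑ j : Fin m, ∑ i, Mk.v i univ :=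
    Finset.sum_le_sum fun j _ => auction_bound Mk q ε hq S k h1 j
  rw [← Finset.mul_sum] at h3
  simp only [Finset.sum_const, Finset.card_univ, Fintype.card_fin, nsmul_eq_mul] at h3
  rw [div_lt_iff₀ hε] at hN
  have h4 : (N : ℝ) ≤ ∑ j, (k j : ℝ) := by exact_mod_cast h2
  nlinarith

/-- Approximate equilibrium condition. -/
def approxEq {n m : ℕ} (Mk : Market n m) (q δ : ℝ) (S : Fin n → Finset (Fin m)) :
    Set (Fin m → ℝ) :=
  {p | (∀ j, q ≤ p j) ∧ (∀ j, p j ≤ q + ∑ i, Mk.v i univ) ∧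
    (∀ j, j ∉ Finset.univ.biUnion S → p j = q) ∧
    ∀ i, ∀ T, Mk.v i T - ∑ j ∈ T, p j ≤ Mk.v i (S i) - ∑ j ∈ S i, p j + δ}

lemma exists_approx {n m : ℕ} (Mk : Market n m) (hgs : ∀ i, GS (Mk.v i)) (q ε : ℝ)
    (hq : 0 ≤ q) (hε : 0 < ε) :
    ∃ S, IsAllocation S ∧ (approxEq Mk q (m * ε) S).Nonempty := by
  obtain ⟨S, k, h, hd⟩ := auction_terminal Mk hgs q ε hq hε
  refine ⟨S, h.1, fun j => q + ε * k j, fun j => ?_, fun j => ?_, fun j hj => ?_, fun i T => ?_⟩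
  · have : 0 ≤ ε * k j := by positivity
    linarith
  · have := auction_bound Mk q ε hq S k h j
    linarith
  · simp [h.2.1 j hj]
  · have h1 := hd i T
    have h2 : ∑ j ∈ S i, seenPrice q ε k (S i) j = ∑ j ∈ S i, (q + ε * k j) :=
      Finset.sum_congr rfl fun j hj => by simp [seenPrice, hj]
    have h3 : ∑ j ∈ T, seenPrice q ε k (S i) j ≤ ∑ j ∈ T, (q + ε * k j) + m * ε := by
      calc ∑ j ∈ T, seenPrice q ε k (S i) j ≤ ∑ j ∈ T, ((q + ε * k j) + ε) := by
            apply Finset.sum_le_sum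
            intro j _
            unfold seenPrice
            split_ifs <;> linarith
        _ = ∑ j ∈ T, (q + ε * k j) + T.card * ε := by
            rw [Finset.sum_add_distrib]; simp
        _ ≤ _ := by
            have : (T.card : ℝ) ≤ m := by
              exact_mod_cast (Finset.card_le_univ T).trans (by simp)
            nlinarith
    linarith

lemma exists_equilibrium {n m : ℕ} (Mk : Market n m) (hgs : ∀ i, GS (Mk.v i)) (q : ℝ)
    (hq : 0 ≤ q) : ∃ S p, IsAllocation S ∧ p ∈ approxEq Mk q 0 S := by
  have h1 : ∀ t : ℕ, ∃ S, IsAllocation S ∧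
      (approxEq Mk q (m * (1 / ((t : ℝ) + 1))) S).Nonempty :=
    fun t => exists_approx Mk hgs q _ hq (by positivity)
  choose S hS hp using h1
  obtain ⟨R, hR⟩ := Finite.exists_infinite_fiber S
  have hR' : (S ⁻¹' {R}).Infinite := Set.infinite_coe_iff.1 hR
  have hmono : ∀ δ δ' : ℝ, δ ≤ δ' → approxEq Mk q δ R ⊆ approxEq Mk q δ' R := by
    intro δ δ' hδ p hp
    exact ⟨hp.1, hp.2.1, hp.2.2.1, fun i T => by have := hp.2.2.2 i T; linarith⟩
  have hclosed : ∀ δ, IsClosed (approxEq Mk q δ R) := by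
    intro δ
    unfold approxEq
    simp only [Set.ofPred_and, Set.ofPred_forall]
    refine IsClosed.inter ?_ (IsClosed.inter ?_ (IsClosed.inter ?_ ?_))
    · exact isClosed_iInter fun j => isClosed_le (by fun_prop) (by fun_prop)
    · exact isClosed_iInter fun j => isClosed_le (by fun_prop) (by fun_prop)
    · exact isClosed_iInter fun j => isClosed_iInter fun _ =>
        isClosed_eq (by fun_prop) (by fun_prop)
    · exact isClosed_iInter fun i => isClosed_iInter fun T =>
        isClosed_le (by fun_prop) (by fun_prop)
  have hcompact : IsCompact (approxEq Mk q (m * (1 / (((0 : ℕ) : ℝ) + 1))) R) := by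
    refine IsCompact.of_isClosed_subset
      (isCompact_univ_pi fun _ : Fin m => isCompact_Icc (a := q) (b := q + ∑ i, Mk.v i univ))
      (hclosed _) ?_
    intro p hp j _
    exact ⟨hp.1 j, hp.2.1 j⟩
  have hstep : ∀ s t : ℕ, s ≤ t →
      (m : ℝ) * (1 / ((t : ℝ) + 1)) ≤ m * (1 / ((s : ℝ) + 1)) := by
    intro s t hst
    have : (s : ℝ) ≤ t := by exact_mod_cast hst
    gcongr
  obtain ⟨p, hp'⟩ := IsCompact.nonempty_iInter_of_sequence_nonempty_isCompact_isClosed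
    (fun t : ℕ => approxEq Mk q (m * (1 / ((t : ℝ) + 1))) R)
    (fun t => hmono _ _ (hstep t (t + 1) (by omega)))
    (fun t => by
      obtain ⟨s, hs, hts⟩ := hR'.exists_gt t
      have hs' : S s = R := hs
      have := hp s
      rw [hs'] at this
      exact this.mono (hmono _ _ (hstep t s hts.le)))
    hcompact (fun t => hclosed _)
  rw [Set.mem_iInter] at hp'
  obtain ⟨s, hs⟩ := hR'.nonempty
  have hs' : S s = R := hs
  refine ⟨R, p, hs' ▸ hS s, (hp' 0).1, (hp' 0).2.1, (hp' 0).2.2.1, fun i T => ?_⟩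
  have hlim : Filter.Tendsto (fun t : ℕ => Mk.v i (R i) - ∑ j ∈ R i, p j +
      m * (1 / ((t : ℝ) + 1))) Filter.atTop (nhds (Mk.v i (R i) - ∑ j ∈ R i, p j + m * 0)) :=
    (tendsto_one_div_add_atTop_nhds_zero_nat.const_mul _).const_add _
  rw [mul_zero] at hlim
  exact ge_of_tendsto' hlim fun t => (hp' t).2.2.2 i T

/-- If `U` is independent with all weights above the reserve, its unsold part is no larger
than the demanded set. -/
lemma unsold_card {m : ℕ} (v : Finset (Fin m) → ℝ) (M : Matroid (Fin m)) (w : Fin m → ℝ)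
    (hE : M.E = Set.univ)
    (hv : ∀ S : Finset (Fin m),
      IsGreatest {x : ℝ | ∃ U : Finset (Fin m), U ⊆ S ∧ M.Indep ↑U ∧ x = ∑ j ∈ U, w j} (v S))
    (q : ℝ) (p : Fin m → ℝ) (D : Finset (Fin m)) (hD : Demanded v p D)
    (U : Finset (Fin m)) (hU : M.Indep ↑U) (hUq : ∀ j ∈ U, p j = q ∧ q < w j ∧ j ∉ D) :
    U.card ≤ D.card := by
  have hsub : (U : Set (Fin m)) ⊆ M.closure ↑D := by
    intro j hj
    by_contra hcl
    obtain ⟨hpq, hqw, hjD⟩ := hUq j hj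
    obtain ⟨V, hVD, hV, hvV⟩ := (hv D).1
    have hjV : j ∉ V := fun h => hjD (hVD h)
    have hcl' : j ∉ M.closure ↑V := fun h =>
      hcl (M.closure_subset_closure (by exact_mod_cast hVD) h)
    have hins : M.Indep ((insert j V : Finset (Fin m)) : Set (Fin m)) := by
      have := (hV.notMem_closure_iff (e := j) (by simp [hE])).1 hcl'
      simpa using this.1
    have h1 : ∑ l ∈ insert j V, w l ≤ v (insert j D) :=
      (hv _).2 ⟨_, Finset.insert_subset_insert j hVD, hins, rfl⟩
    rw [Finset.sum_insert hjV] at h1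
    have h2 := hD (insert j D)
    rw [Finset.sum_insert hjD] at h2
    linarith
  have h1 : (U : Set (Fin m)).encard ≤ (D : Set (Fin m)).encard :=
    calc (U : Set (Fin m)).encard ≤ M.eRk (M.closure ↑D) := hU.encard_le_eRk_of_subset hsub
      _ = M.eRk ↑D := M.eRk_closure_eq _
      _ ≤ _ := M.eRk_le_encard _
  simpa using h1

lemma exists_opt {n m : ℕ} (Mk : Market n m) :
    ∃ S, IsAllocation S ∧ allocWelfare Mk S = OPT Mk := by
  have hfin : {w : ℝ | ∃ S : Fin n → Finset (Fin m), IsAllocation S ∧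
      allocWelfare Mk S = w}.Finite := by
    apply (Set.finite_range (allocWelfare Mk)).subset
    rintro w ⟨S, _, rfl⟩
    exact ⟨S, rfl⟩
  have hne : {w : ℝ | ∃ S : Fin n → Finset (Fin m), IsAllocation S ∧
      allocWelfare Mk S = w}.Nonempty :=
    ⟨allocWelfare Mk fun _ => ∅, fun _ => ∅, fun _ _ _ => by simp, rfl⟩
  exact hne.csSup_mem hfin

/-- There is an absolute constant `c > 0` such that every market in which
each valuation is a weighted matroid rank function admits a price `q ≥ 0` and a
competitive equilibrium with reserve `q` whose revenue is at least
`c * OPT / (log₂ m + 2)`. -/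
theorem weighted_matroid_rank_reserve_equilibrium :
    ∃ c : ℝ, 0 < c ∧
      ∀ (n m : ℕ), 1 ≤ n → 1 ≤ m → ∀ (Mk : Market n m),
        (∀ i : Fin n, ∃ (ℳ : Matroid (Fin m)) (w : Fin m → ℝ), ℳ.E = Set.univ ∧
          (∀ j, 0 ≤ w j) ∧
          ∀ S : Finset (Fin m),
            IsGreatest
              {x : ℝ | ∃ U : Finset (Fin m), U ⊆ S ∧ ℳ.Indep ↑U ∧ x = ∑ j ∈ U, w j}
              (Mk.v i S)) →
        ∃ (q : ℝ) (S : Fin n → Finset (Fin m)) (p : Fin m → ℝ),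
          0 ≤ q ∧ IsAllocation S ∧
          (∀ j, q ≤ p j) ∧
          (∀ j, j ∉ Finset.univ.biUnion S → p j = q) ∧
          (∀ i, ∀ T : Finset (Fin m),
            Mk.v i (S i) - ∑ j ∈ S i, p j ≥ Mk.v i T - ∑ j ∈ T, p j) ∧
          ∑ j ∈ Finset.univ.biUnion S, p j ≥ c * OPT Mk / (Real.logb 2 m + 2) := by
  classical
  refine ⟨1 / 4, by norm_num, ?_⟩
  intro n m hn hm Mk hMk
  choose M w hE hw hv using hMk
  have hgs : ∀ i, GS (Mk.v i) := fun i => gs_of_exch _ (exch_of_matroid _ (M i) (w i) (hE i) (hv i))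
  have hlogm : 0 ≤ Real.log m := Real.log_natCast_nonneg m
  have hlog : Real.log m ≤ Real.logb 2 m := by
    rw [Real.logb, le_div_iff₀ (Real.log_pos (by norm_num))]
    have : Real.log 2 ≤ 1 := by linarith [Real.log_two_lt_d9]
    nlinarith
  have hL : 0 < Real.logb 2 m + 2 := by linarith
  rcases le_or_gt (OPT Mk) 0 with hO | hO
  · obtain ⟨S, p, hS, hp⟩ := exists_equilibrium Mk hgs 0 le_rfl
    refine ⟨0, S, p, le_rfl, hS, hp.1, hp.2.2.1, fun i T => ?_, ?_⟩
    · have := hp.2.2.2 i T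
      linarith
    · have h1 : 0 ≤ ∑ j ∈ Finset.univ.biUnion S, p j := Finset.sum_nonneg fun j _ => hp.1 j
      have h2 : 1 / 4 * OPT Mk / (Real.logb 2 m + 2) ≤ 0 :=
        div_nonpos_of_nonpos_of_nonneg (by linarith) hL.le
      linarith
  obtain ⟨A, hA, hAopt⟩ := exists_opt Mk
  have hU : ∀ i, ∃ U : Finset (Fin m), U ⊆ A i ∧ (M i).Indep ↑U ∧
      Mk.v i (A i) = ∑ j ∈ U, w i j := fun i => (hv i (A i)).1
  choose U hUA hUI hUv using hU
  have hUdisj : ∀ i j : Fin n, i ≠ j → Disjoint (U i) (U j) :=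
    fun i j hij => (hA i j hij).mono (hUA i) (hUA j)
  set I : Finset (Σ _ : Fin n, Fin m) := Finset.univ.sigma U with hI
  set a : (Σ _ : Fin n, Fin m) → ℝ := fun e => w e.1 e.2 with ha
  have hsum : ∑ e ∈ I, a e = OPT Mk := by
    rw [hI, Finset.sum_sigma, ← hAopt]
    exact Finset.sum_congr rfl fun i _ => (hUv i).symm
  have hcard : I.card ≤ m := by
    rw [hI, Finset.card_sigma, ← Finset.card_biUnion (fun i _ j _ hij => hUdisj i j hij)]
    exact (Finset.card_le_univ _).trans (by simp)
  obtain ⟨e, heI, he⟩ : ∃ e ∈ I, OPT Mk / (Real.logb 2 m + 2) <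
      a e * ((I.filter fun f => a e ≤ a f).card : ℝ) := by
    by_contra hcon
    push Not at hcon
    have h1 := sum_le_harmonic a (OPT Mk / (Real.logb 2 m + 2)) I.card I rfl hcon
      (fun f _ => hw f.1 f.2)
    have h2 : (harmonic I.card : ℝ) ≤ 1 + Real.log m := by
      refine (harmonic_le_one_add_log _).trans ?_
      rcases Nat.eq_zero_or_pos I.card with h0 | h0
      · rw [h0]; simpa using hlogm
      · have : Real.log I.card ≤ Real.log m :=
          Real.log_le_log (by exact_mod_cast h0) (by exact_mod_cast hcard)
        linarith
    rw [hsum] at h1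
    have h3 : 0 < OPT Mk / (Real.logb 2 m + 2) := div_pos hO hL
    have h4 : OPT Mk / (Real.logb 2 m + 2) * (Real.logb 2 m + 2) = OPT Mk :=
      div_mul_cancel₀ _ hL.ne'
    nlinarith
  have hae : 0 < a e := by
    have h3 : 0 < OPT Mk / (Real.logb 2 m + 2) := div_pos hO hL
    by_contra hcon
    have h0 : a e = 0 := le_antisymm (not_lt.1 hcon) (hw e.1 e.2)
    rw [h0] at he
    linarith
  obtain ⟨S, p, hS, hp⟩ := exists_equilibrium Mk hgs (a e / 2) (by linarith)
  refine ⟨a e / 2, S, p, by linarith, hS, hp.1, hp.2.2.1, fun i T => ?_, ?_⟩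
  · have := hp.2.2.2 i T
    linarith
  set X := Finset.univ.biUnion S with hX
  have hXcard : X.card = ∑ i, (S i).card := Finset.card_biUnion fun i _ j _ hij => hS i j hij
  have hN : (I.filter fun f => a e ≤ a f).card ≤ 2 * X.card := by
    have h1 : (I.filter fun f => a e ≤ a f) =
        Finset.univ.sigma (fun i => (U i).filter fun j => a e ≤ w i j) := by
      ext ⟨i, j⟩
      simp [hI, ha]
    rw [h1, Finset.card_sigma]
    have h2 : ∀ i, ((U i).filter fun j => a e ≤ w i j).card ≤ (U i ∩ X).card + (S i).card := by
      intro i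
      have h3 : ((U i).filter fun j => a e ≤ w i j ∧ j ∉ X).card ≤ (S i).card := by
        apply unsold_card (Mk.v i) (M i) (w i) (hE i) (hv i) (a e / 2) p (S i)
        · intro T
          have := hp.2.2.2 i T
          linarith
        · exact (hUI i).subset (by exact_mod_cast Finset.filter_subset _ _)
        · intro j hj
          rw [Finset.mem_filter] at hj
          refine ⟨hp.2.2.1 j hj.2.2, by linarith [hj.2.1], fun h => hj.2.2 ?_⟩
          rw [hX]
          exact Finset.mem_biUnion.2 ⟨i, Finset.mem_univ _, h⟩
      refine le_trans (Finset.card_le_card ?_) ((Finset.card_union_le (U i ∩ X) _).trans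
        (Nat.add_le_add_left h3 _))
      intro j hj
      simp only [Finset.mem_filter, Finset.mem_union, Finset.mem_inter] at hj ⊢
      tauto
    have h4 : ∑ i, (U i ∩ X).card ≤ X.card := by
      rw [← Finset.card_biUnion (fun i _ j _ hij => (hUdisj i j hij).mono
        Finset.inter_subset_left Finset.inter_subset_left)]
      apply Finset.card_le_card
      intro j hj
      simp only [Finset.mem_biUnion, Finset.mem_inter] at hj
      obtain ⟨_, _, _, h⟩ := hj
      exact h
    have h5 := Finset.sum_le_sum fun i (_ : i ∈ (Finset.univ : Finset (Fin n))) => h2 i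
    rw [Finset.sum_add_distrib] at h5
    omega
  have hrev : (X.card : ℝ) * (a e / 2) ≤ ∑ j ∈ X, p j := by
    have := Finset.card_nsmul_le_sum X p (a e / 2) fun j _ => hp.1 j
    simpa using this
  have hN' : ((I.filter fun f => a e ≤ a f).card : ℝ) ≤ 2 * X.card := by exact_mod_cast hN
  rw [mul_div_assoc]
  nlinarith
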